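/- For every odd integer ℓ ≥ 3 and every integer p ≥ 1, Bob has a winning strategy in the coloring game with 4 colors on the graph G(ℓ, p); equivalently, χ_g(G(ℓ, p)) ≥ 5. -/

import Mathlib

namespace GCN

/-- The player whose turn it is. -/
inductive Player : Type
  | alice : Player
  | bob : Player

variable {V α : Type}

/-- A move consisting of coloring the uncolored vertex `v` with color `a` is legal in the
partial coloring `c` if `v` is uncolored and no neighbor of `v` has color `a`. -/
def legalMove (G : SimpleGraph V) (c : V → Option α) (v : V) (a : α) : Prop :=
  c v = none ∧ ∀ u, G.Adj v u → c u ≠ some a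

/-- The partial coloring obtained by coloring vertex `v` with color `a`. -/
def applyMove [DecidableEq V] (c : V → Option α) (v : V) (a : α) : V → Option α :=
  Function.update c v (some a)

/-- `BobWins G p c` : in the coloring game on `G` starting from the partial coloring `c` with
player `p` to move (the moving player must color an uncolored vertex properly whenever a legal
move exists; the game ends when no legal move exists), Bob has a strategy guaranteeing that the
game ends with some vertex uncolored. -/
inductive BobWins [DecidableEq V] (G : SimpleGraph V) : Player → (V → Option α) → Prop
  | endPos (p : Player) (c : V → Option α)
      (hend : ∀ v a, ¬ legalMove G c v a) (hunc : ∃ v, c v = none) : BobWins G p c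
  | aliceMove (c : V → Option α)
      (hmoves : ∃ v a, legalMove G c v a)
      (h : ∀ v a, legalMove G c v a → BobWins G .bob (applyMove c v a)) :
      BobWins G .alice c
  | bobMove (c : V → Option α) (v : V) (a : α)
      (hmove : legalMove G c v a)
      (h : BobWins G .alice (applyMove c v a)) : BobWins G .bob c

/-- `AliceWins G p c` : in the coloring game on `G` starting from the partial coloring `c` with
player `p` to move, Alice has a strategy guaranteeing that the game ends with all vertices
colored. -/
inductive AliceWins [DecidableEq V] (G : SimpleGraph V) : Player → (V → Option α) → Prop
  | endPos (p : Player) (c : V → Option α)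
      (hend : ∀ v a, ¬ legalMove G c v a) (hall : ∀ v, c v ≠ none) : AliceWins G p c
  | aliceMove (c : V → Option α) (v : V) (a : α)
      (hmove : legalMove G c v a)
      (h : AliceWins G .bob (applyMove c v a)) : AliceWins G .alice c
  | bobMove (c : V → Option α)
      (hmoves : ∃ v a, legalMove G c v a)
      (h : ∀ v a, legalMove G c v a → AliceWins G .alice (applyMove c v a)) :
      AliceWins G .bob c

/-- The game chromatic number of `G` : the least number `k` of colors such that Alice has a
winning strategy in the coloring game on `G` played with `k` colors (Alice moving first,
starting from the everywhere-uncolored position). -/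
noncomputable def gameChromaticNumber [DecidableEq V] (G : SimpleGraph V) : ℕ :=
  sInf {k : ℕ | AliceWins (α := Fin k) G .alice (fun _ => none)}

/-- `c` is a partial proper coloring of `G` : adjacent colored vertices get distinct colors. -/
def ProperPartial (G : SimpleGraph V) (c : V → Option α) : Prop :=
  ∀ ⦃u v : V⦄, G.Adj u v → ∀ a : α, c u = some a → c v ≠ some a

/-- `Phi G c v` : the set of colors appearing (under `c`) on the neighbors of `v`. -/
def Phi (G : SimpleGraph V) (c : V → Option α) (v : V) : Set α :=
  {a : α | ∃ u, G.Adj v u ∧ c u = some a}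

end GCN

namespace GCN

/-- Vertices of one copy of the core construction : either one of the five spine vertices
`x y z y' x'` (indexed by `Fin 5`), or a vertex of one of the two attachments of a spine
vertex.  An attachment is a path of length `p` from the spine vertex to an `ℓ`-cycle : its
vertices are the `p - 1` interior path vertices (`Fin (p - 1)`, the vertex indexed by `i`
being at distance `i + 1` from the spine vertex) together with the `ℓ` cycle vertices
(`Fin ℓ`, the cycle vertex `0` being the endpoint of the attaching path). -/
abbrev BaseV (ℓ p : ℕ) : Type := Fin 5 ⊕ Fin 5 × Fin 2 × (Fin (p - 1) ⊕ Fin ℓ)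

/-- Vertices of the two disjoint copies of the core construction. -/
abbrev CoreV (ℓ p : ℕ) : Type := Bool × BaseV ℓ p

/-- Vertices of the graph `G(ℓ, p)` : a core vertex `v` is represented by `(v, none)`, and its
eight pendant leaves are `(v, some i)` for `i : Fin 8`. -/
abbrev GV (ℓ p : ℕ) : Type := CoreV ℓ p × Option (Fin 8)

/-- The adjacency relation of one copy of the core construction. -/
def baseAdj (ℓ p : ℕ) : BaseV ℓ p → BaseV ℓ p → Prop
  | .inl s, .inl t => s.val + 1 = t.val ∨ t.val + 1 = s.val
  | .inl s, .inr (s', _, .inl i) => s = s' ∧ i.val = 0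
  | .inr (s', _, .inl i), .inl s => s = s' ∧ i.val = 0
  | .inl s, .inr (s', _, .inr c) => s = s' ∧ p = 1 ∧ c.val = 0
  | .inr (s', _, .inr c), .inl s => s = s' ∧ p = 1 ∧ c.val = 0
  | .inr (s, j, .inl i), .inr (s', j', .inl i') =>
      s = s' ∧ j = j' ∧ (i.val + 1 = i'.val ∨ i'.val + 1 = i.val)
  | .inr (s, j, .inl i), .inr (s', j', .inr d) =>
      s = s' ∧ j = j' ∧ i.val + 1 = p - 1 ∧ d.val = 0
  | .inr (s, j, .inr d), .inr (s', j', .inl i) =>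
      s = s' ∧ j = j' ∧ i.val + 1 = p - 1 ∧ d.val = 0
  | .inr (s, j, .inr d), .inr (s', j', .inr d') =>
      s = s' ∧ j = j' ∧ ((d.val + 1) % ℓ = d'.val ∨ (d'.val + 1) % ℓ = d.val)

/-- The adjacency relation of `G(ℓ, p)` : core vertices are adjacent within the same copy
according to `baseAdj`, and each leaf is adjacent exactly to the core vertex it hangs from. -/
def gAdj (ℓ p : ℕ) : GV ℓ p → GV ℓ p → Prop
  | ((b, x), none), ((b', y), none) => b = b' ∧ baseAdj ℓ p x y
  | (v, none), (w, some _) => v = w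
  | (v, some _), (w, none) => v = w
  | (_, some _), (_, some _) => False

/-- The graph `G(ℓ, p)` : a path on five vertices `x y z y' x'`, two cycles of length `ℓ`
attached to each of these five vertices by paths of length `p`, all of this taken in two
disjoint copies, and 8 pendant leaves attached to every vertex. -/
def GraphLP (ℓ p : ℕ) : SimpleGraph (GV ℓ p) := SimpleGraph.fromRel (gAdj ℓ p)


instance (ℓ p : ℕ) : DecidableEq (GV ℓ p) := instDecidableEqProd

instance (ℓ p : ℕ) : Fintype (GV ℓ p) := instFintypeProd _ _

noncomputable instance (ℓ p : ℕ) : DecidableRel (GraphLP ℓ p).Adj := Classical.decRel _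

end GCN

namespace GCN

section Game

variable {V α : Type} {G : SimpleGraph V} {c : V → Option α}

theorem legalMove.notMem_Phi {v : V} {a : α} (h : legalMove G c v a) : a ∉ Phi G c v :=
  fun ⟨u, hu, hc⟩ => h.2 u hu hc

theorem exists_legalMove_of_card_lt [Fintype V] [Fintype α]
    (hcard : Fintype.card V < Fintype.card α) {v : V} (hv : c v = none) :
    ∃ a, legalMove G c v a := by
  by_contra! h
  have hsurj : ∀ a : α, ∃ u, c u = some a := by
    intro a
    by_contra! ha
    exact h a ⟨hv, fun u _ => ha u⟩
  choose f hf using hsurj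
  have hinj : Function.Injective f := fun a b hab =>
    Option.some_injective _ ((hf a).symm.trans (hab ▸ hf b))
  exact absurd (Fintype.card_le_of_injective f hinj) (not_le.2 hcard)

variable [DecidableEq V]

theorem applyMove_self (c : V → Option α) (w : V) (a : α) : applyMove c w a w = some a := by
  simp [applyMove]

theorem applyMove_of_ne (c : V → Option α) {u w : V} (a : α) (h : u ≠ w) :
    applyMove c w a u = c u := by
  simp [applyMove, h]

theorem Phi_subset_applyMove {w : V} (hw : c w = none) (a : α) (v : V) :
    Phi G c v ⊆ Phi G (applyMove c w a) v := by
  rintro b ⟨u, hu, hb⟩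
  refine ⟨u, hu, ?_⟩
  rw [applyMove_of_ne _ _ (by rintro rfl; simp_all)]
  exact hb

theorem mem_Phi_applyMove {v w : V} (h : G.Adj v w) (a : α) :
    a ∈ Phi G (applyMove c w a) v :=
  ⟨w, h, applyMove_self c w a⟩

theorem BobWins.of_alice (hunc : ∃ v, c v = none)
    (h : ∀ v a, legalMove G c v a → BobWins G .bob (applyMove c v a)) :
    BobWins G .alice c := by
  by_cases hm : ∃ v a, legalMove G c v a
  · exact .aliceMove c hm h
  · push Not at hm
    exact .endPos _ c hm hunc

theorem ncard_uncolored_applyMove_lt [Finite V] {w : V} (hw : c w = none) (a : α) :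
    {u | applyMove c w a u = none}.ncard < {u | c u = none}.ncard := by
  refine Set.ncard_lt_ncard ?_
  rw [Set.ssubset_iff_of_subset]
  · exact ⟨w, hw, by simp [applyMove_self]⟩
  · intro u hu
    by_cases huw : u = w
    · subst huw; exact hw
    · simpa [applyMove_of_ne c a huw] using hu

/-- An uncolored vertex which sees every color can never be colored. -/
theorem BobWins.of_dead [Finite V] (p : Player) {v : V} (hv : c v = none)
    (hall : ∀ a, a ∈ Phi G c v) : BobWins G p c := by
  induction hn : {u | c u = none}.ncard using Nat.strong_induction_on generalizing c p with
  | _ n ih =>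
    subst hn
    have step : ∀ w a, legalMove G c w a → ∀ q, BobWins G q (applyMove c w a) := by
      intro w a hwa q
      have hvw : v ≠ w := by
        rintro rfl
        exact hwa.notMem_Phi (hall a)
      exact ih _ (ncard_uncolored_applyMove_lt hwa.1 a) q
        (by rw [applyMove_of_ne _ _ hvw]; exact hv)
        (fun b => Phi_subset_applyMove hwa.1 a v (hall b)) rfl
    by_cases hm : ∃ w a, legalMove G c w a
    · cases p with
      | alice => exact .aliceMove c hm fun w a h => step w a h _
      | bob =>
        obtain ⟨w, a, h⟩ := hm
        exact .bobMove c w a h (step w a h _)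
    · push Not at hm
      exact .endPos p c hm ⟨v, hv⟩

theorem AliceWins.not_bobWins {p : Player} (hA : AliceWins G p c) : ¬ BobWins G p c := by
  intro hB
  induction hB with
  | endPos p c hend hunc =>
    obtain ⟨v, hv⟩ := hunc
    cases hA with
    | endPos _ _ _ hall => exact hall v hv
    | aliceMove _ w a hm _ => exact hend w a hm
    | bobMove _ hm _ =>
      obtain ⟨w, a, h⟩ := hm
      exact hend w a h
  | aliceMove c hm h ih =>
    cases hA with
    | endPos _ _ hend _ =>
      obtain ⟨w, a, h⟩ := hm
      exact hend w a h
    | aliceMove _ w a hwa hA => exact ih w a hwa hA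
  | bobMove c v a hm h ih =>
    cases hA with
    | endPos _ _ hend _ => exact hend v a hm
    | bobMove _ _ hA => exact ih (hA v a hm)

theorem ProperPartial.applyMove (hc : ProperPartial G c) {w : V} {a : α}
    (h : legalMove G c w a) : ProperPartial G (applyMove c w a) := by
  intro u v huv b hu hv
  by_cases huw : u = w
  · subst huw
    rw [applyMove_self] at hu
    rw [applyMove_of_ne _ _ huv.ne'] at hv
    exact h.2 v huv (hv.trans hu.symm)
  · rw [applyMove_of_ne _ _ huw] at hu
    by_cases hvw : v = w
    · subst hvw
      rw [applyMove_self] at hv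
      exact h.2 u huv.symm (hu.trans hv.symm)
    · rw [applyMove_of_ne _ _ hvw] at hv
      exact hc huv b hu hv

theorem AliceWins.exists_coloring {p : Player} (hA : AliceWins G p c)
    (hc : ProperPartial G c) : Nonempty (G.Coloring α) := by
  induction hA with
  | endPos p c hend hall =>
    have h : ∀ v, ∃ a, c v = some a := fun v => Option.ne_none_iff_exists'.1 (hall v)
    choose f hf using h
    exact ⟨.mk f fun {u v} huv heq => hc huv (f u) (hf u) (heq ▸ hf v)⟩
  | aliceMove c v a hm h ih => exact ih (hc.applyMove hm)
  | bobMove c hm h ih =>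
    obtain ⟨v, a, hva⟩ := hm
    exact ih v a hva (hc.applyMove hva)

theorem aliceWins_of_card_lt [Fintype V] [Fintype α]
    (hcard : Fintype.card V < Fintype.card α) (p : Player) (c : V → Option α) :
    AliceWins G p c := by
  induction hn : {u | c u = none}.ncard using Nat.strong_induction_on generalizing c p with
  | _ n ih =>
    subst hn
    by_cases hall : ∀ v, c v ≠ none
    · exact .endPos p c (fun v a h => hall v h.1) hall
    · push Not at hall
      obtain ⟨v, hv⟩ := hall
      obtain ⟨a, ha⟩ := exists_legalMove_of_card_lt (G := G) hcard hv
      have step : ∀ q w b, legalMove G c w b → AliceWins G q (applyMove c w b) :=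
        fun q w b h => ih _ (ncard_uncolored_applyMove_lt h.1 b) q _ rfl
      cases p with
      | alice => exact .aliceMove c v a ha (step _ v a ha)
      | bob => exact .bobMove c ⟨v, a, ha⟩ fun w b h => step _ w b h

end Game

section Pendant

variable {W α : Type} {G : SimpleGraph (W × Option (Fin 8))}
  {c : W × Option (Fin 8) → Option α}

/-- The vertices `(v, some i)` are pendant leaves hanging from `(v, none)`. -/
def HasPendantLeaves (G : SimpleGraph (W × Option (Fin 8))) : Prop :=
  ∀ v i u, G.Adj (v, some i) u ↔ u = (v, none)

/-- The number of uncolored leaves at a core vertex. -/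
noncomputable def freeLeaves (c : W × Option (Fin 8) → Option α) (v : W) : ℕ :=
  {i : Fin 8 | c (v, some i) = none}.ncard

theorem exists_leaf_legalMove (hG : HasPendantLeaves G) {v : W} (hv : c (v, none) = none)
    (hf : 1 ≤ freeLeaves c v) : ∃ i, ∀ a, legalMove G c (v, some i) a := by
  obtain ⟨i, hi⟩ := Set.nonempty_of_ncard_ne_zero (Nat.one_le_iff_ne_zero.1 hf)
  refine ⟨i, fun a => ⟨hi, fun u hu => ?_⟩⟩
  rw [(hG v i u).1 hu, hv]
  simp

/-- A path of uncolored core vertices whose interior vertices have plenty of free leaves. -/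
structure FreshPath (G : SimpleGraph (W × Option (Fin 8))) (c : W × Option (Fin 8) → Option α)
    (v : ℕ → W) (d : ℕ) : Prop where
  adj : ∀ i < d, G.Adj (v i, none) (v (i + 1), none)
  inj : ∀ i ≤ d, ∀ j ≤ d, v i = v j → i = j
  unc : ∀ i ≤ d, c (v i, none) = none
  free : ∀ i, 0 < i → i < d → 6 ≤ freeLeaves c (v i)

namespace FreshPath

variable {v : ℕ → W} {d : ℕ}

theorem take (h : FreshPath G c v d) {m : ℕ} (hm : m ≤ d) : FreshPath G c v m where
  adj i hi := h.adj i (by omega)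
  inj i hi j hj := h.inj i (by omega) j (by omega)
  unc i hi := h.unc i (by omega)
  free i h0 hi := h.free i h0 (by omega)

theorem reverse (h : FreshPath G c v d) : FreshPath G c (fun i => v (d - i)) d where
  adj i hi := by
    have := h.adj (d - (i + 1)) (by omega)
    rw [show d - (i + 1) + 1 = d - i by omega] at this
    exact this.symm
  inj i hi j hj hij := by
    have := h.inj _ (by omega) _ (by omega) hij
    omega
  unc i hi := h.unc _ (by omega)
  free i h0 hi := h.free _ (by omega) (by omega)

end FreshPath

/-- `v` sees every color of the class `b` of `χ`. -/
def Sees (G : SimpleGraph (W × Option (Fin 8))) (χ : α → Bool) (c : W × Option (Fin 8) → Option α)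
    (v : W) (b : Bool) : Prop :=
  ∀ a, χ a = b → a ∈ Phi G c (v, none)

/-- Both classes of `χ` have at most two colors. -/
def SmallClasses (χ : α → Bool) : Prop :=
  ∀ b, ∃ f g, ∀ a, χ a = b → a = f ∨ a = g

theorem odd_split {b b' : Bool} {d i : ℕ} (hid : i ≤ d) (hpar : Odd d ↔ b = b') (x : Bool) :
    (Odd i ↔ b = x) ∨ (Odd (d - i) ↔ b' = x) := by
  simp only [Nat.odd_iff] at *
  cases b <;> cases b' <;> cases x <;> simp at * <;> omega

theorem odd_split_of_ne {b b' x : Bool} {d i : ℕ} (hid : i ≤ d) (hpar : Odd d ↔ b = b')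
    (h0 : i = 0 → x ≠ b) (hd : i = d → x ≠ b') :
    (0 < i ∧ (Odd (i - 1) ↔ b = x)) ∨ (0 < d - i ∧ (Odd (d - i - 1) ↔ b' = x)) := by
  simp only [Nat.odd_iff] at *
  cases b <;> cases b' <;> cases x <;> simp at * <;> omega

variable [DecidableEq (W × Option (Fin 8))]

theorem freeLeaves_applyMove_of_ne {v : W} {w : W × Option (Fin 8)} (a : α)
    (h : ∀ i, w ≠ (v, some i)) : freeLeaves (applyMove c w a) v = freeLeaves c v := by
  unfold freeLeaves
  congr 1
  ext i
  simp [applyMove_of_ne c a (h i).symm]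

theorem freeLeaves_le_applyMove (c : W × Option (Fin 8) → Option α) (v : W)
    (w : W × Option (Fin 8)) (a : α) :
    freeLeaves c v ≤ freeLeaves (applyMove c w a) v + 1 := by
  by_cases h : ∃ i, w = (v, some i)
  · obtain ⟨i, rfl⟩ := h
    refine le_trans (Set.ncard_le_ncard ?_) (Set.ncard_insert_le i _)
    intro j hj
    by_cases hij : j = i
    · exact .inl hij
    · right
      have : ((v, some j) : W × Option (Fin 8)) ≠ (v, some i) := by simpa using hij
      simpa [applyMove_of_ne c a this] using hj
  · push Not at h
    rw [freeLeaves_applyMove_of_ne a h]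
    exact Nat.le_succ _

theorem HasPendantLeaves.mem_Phi (hG : HasPendantLeaves G) (v : W) (i : Fin 8) (a : α) :
    a ∈ Phi G (applyMove c (v, some i) a) (v, none) :=
  mem_Phi_applyMove ((hG v i _).2 rfl).symm a

/-- Bob blocks an uncolored vertex that sees all colors but one. -/
theorem BobWins.of_almost_dead [Finite W] (hG : HasPendantLeaves G) {v : W}
    (hv : c (v, none) = none) (hf : 1 ≤ freeLeaves c v) (b : α)
    (hall : ∀ a, a ≠ b → a ∈ Phi G c (v, none)) : BobWins G .bob c := by
  obtain ⟨i, hi⟩ := exists_leaf_legalMove hG hv hf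
  refine .bobMove c _ b (hi b) (.of_dead _ (v := (v, none)) ?_ fun a => ?_)
  · rw [applyMove_of_ne _ _ (by simp)]
    exact hv
  · by_cases hab : a = b
    · subst hab
      exact hG.mem_Phi v i a
    · exact Phi_subset_applyMove (hi b).1 b _ (hall a hab)

namespace FreshPath

variable {v : ℕ → W} {d : ℕ}

theorem applyMove (h : FreshPath G c v d) {w : W × Option (Fin 8)} (a : α)
    (hw : ∀ i ≤ d, w ≠ (v i, none)) (hw' : ∀ i, 0 < i → i < d → ∀ j, w ≠ (v i, some j)) :
    FreshPath G (applyMove c w a) v d where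
  adj := h.adj
  inj := h.inj
  unc i hi := by
    rw [applyMove_of_ne _ _ (hw i hi).symm]
    exact h.unc i hi
  free i h0 hi := by
    rw [freeLeaves_applyMove_of_ne _ (hw' i h0 hi)]
    exact h.free i h0 hi

end FreshPath

theorem Sees.applyMove {χ : α → Bool} {v : W} {b : Bool} (h : Sees G χ c v b)
    {w : W × Option (Fin 8)} (hw : c w = none) (a : α) : Sees G χ (applyMove c w a) v b :=
  fun x hx => Phi_subset_applyMove hw a _ (h x hx)

/-- Bob wins, with Alice to move, on every path of length `d` whose ends both see a class of `χ`,
the same class if and only if `d` is odd. -/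
def EndsWin (G : SimpleGraph (W × Option (Fin 8))) (χ : α → Bool) (d : ℕ) : Prop :=
  ∀ (v : ℕ → W) (c : W × Option (Fin 8) → Option α) (b b' : Bool), (Odd d ↔ b = b') →
    FreshPath G c v d → Sees G χ c (v 0) b → Sees G χ c (v d) b' →
    4 ≤ freeLeaves c (v 0) → 4 ≤ freeLeaves c (v d) → BobWins G .alice c

/-- With Bob to move it suffices that one end sees a class and the other end a single color. -/
theorem EndsWin.bobWins [Finite W] (hG : HasPendantLeaves G) {χ : α → Bool}
    (hχ : SmallClasses χ) {d : ℕ} (hd : EndsWin G χ d) {v : ℕ → W} {b : Bool} {a : α}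
    (hpar : Odd d ↔ b = χ a) (hv : FreshPath G c v d) (h0 : Sees G χ c (v 0) b)
    (ha : a ∈ Phi G c (v d, none)) (hf : 0 < d → 4 ≤ freeLeaves c (v 0))
    (hf' : 1 ≤ freeLeaves c (v d)) (hf'' : 0 < d → 5 ≤ freeLeaves c (v d)) :
    BobWins G .bob c := by
  obtain ⟨a', ha'⟩ : ∃ a', ∀ x, χ x = χ a → x = a ∨ x = a' := by
    obtain ⟨f, g, h⟩ := hχ (χ a)
    rcases h a rfl with rfl | rfl
    · exact ⟨g, h⟩
    · exact ⟨f, fun x hx => (h x hx).symm⟩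
  rcases Nat.eq_zero_or_pos d with rfl | hpos
  · refine .of_almost_dead hG (hv.unc 0 le_rfl) hf' a' fun x hx => ?_
    by_cases hxb : χ x = b
    · exact h0 x hxb
    · have : χ x = χ a := by
        have hb : b ≠ χ a := fun h => by simp [h] at hpar
        revert hxb hb
        cases χ x <;> cases χ a <;> cases b <;> simp
      rcases ha' x this with rfl | rfl
      · exact ha
      · exact absurd rfl hx
  · obtain ⟨i, hi⟩ := exists_leaf_legalMove hG (hv.unc d le_rfl) hf'
    have hne : v 0 ≠ v d := fun h => by
      have := hv.inj 0 (by omega) d le_rfl h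
      omega
    refine .bobMove c _ a' (hi a') (hd v _ b (χ a) hpar ?_ (h0.applyMove (hi a').1 _) ?_ ?_ ?_)
    · refine hv.applyMove _ (by simp) fun j _ hj k h => ?_
      have := hv.inj j hj.le d le_rfl (Prod.ext_iff.1 h).1.symm
      omega
    · intro x hx
      rcases ha' x hx with rfl | rfl
      · exact Phi_subset_applyMove (hi a').1 _ _ ha
      · exact hG.mem_Phi _ _ _
    · rw [freeLeaves_applyMove_of_ne]
      · exact hf hpos
      · intro k h
        exact hne (Prod.ext_iff.1 h).1.symm
    · have := freeLeaves_le_applyMove c (v d) (v d, some i) a'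
      have := hf'' hpos
      omega

theorem endsWin [Finite W] (hG : HasPendantLeaves G) {χ : α → Bool}
    (hχ : SmallClasses χ) (d : ℕ) : EndsWin G χ d := by
  induction d using Nat.strong_induction_on with
  | _ d ih =>
    -- an initial segment whose last vertex has just received a color of the right class
    have short : ∀ (v : ℕ → W) (c : W × Option (Fin 8) → Option α) (b : Bool) (a : α) (m : ℕ),
        m < d → (Odd m ↔ b = χ a) → FreshPath G c v m → Sees G χ c (v 0) b →
        a ∈ Phi G c (v m, none) → 4 ≤ freeLeaves c (v 0) → (0 < m → 5 ≤ freeLeaves c (v m)) →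
        BobWins G .bob c := by
      intro v c b a m hm hpar hv h0 ha hf hf'
      refine (ih m hm).bobWins hG hχ hpar hv h0 ha (fun _ => hf) ?_ hf'
      rcases Nat.eq_zero_or_pos m with rfl | h
      · omega
      · have := hf' h
        omega
    -- Alice colors a vertex of the path, and the segment before it is winning
    have cut : ∀ (v : ℕ → W) (c : W × Option (Fin 8) → Option α) (b : Bool) (a : α) (i : ℕ),
        0 < i → i ≤ d → (Odd (i - 1) ↔ b = χ a) → FreshPath G c v d → Sees G χ c (v 0) b →
        4 ≤ freeLeaves c (v 0) → BobWins G .bob (applyMove c (v i, none) a) := by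
      intro v c b a i hi hid hpar hv h0 hf
      have hadj := hv.adj (i - 1) (by omega)
      rw [Nat.sub_add_cancel hi] at hadj
      refine short v _ b a (i - 1) (by omega) hpar ((hv.take (by omega)).applyMove _ ?_ (by simp))
        (h0.applyMove (hv.unc i hid) _) (mem_Phi_applyMove hadj a) ?_ ?_
      · intro j hj h
        have := hv.inj i hid j (by omega) (Prod.ext_iff.1 h).1
        omega
      · rwa [freeLeaves_applyMove_of_ne _ (by simp)]
      · intro h
        rw [freeLeaves_applyMove_of_ne _ (by simp)]
        have := hv.free (i - 1) h (by omega)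
        omega
    -- Alice colors a leaf of an interior vertex, and the segment ending there is winning
    have nip : ∀ (v : ℕ → W) (c : W × Option (Fin 8) → Option α) (b : Bool) (a : α) (i : ℕ)
        (j : Fin 8), 0 < i → i < d → (Odd i ↔ b = χ a) → FreshPath G c v d →
        Sees G χ c (v 0) b → 4 ≤ freeLeaves c (v 0) → c (v i, some j) = none →
        BobWins G .bob (applyMove c (v i, some j) a) := by
      intro v c b a i j hi hid hpar hv h0 hf hc
      refine short v _ b a i hid hpar ((hv.take hid.le).applyMove _ (by simp) ?_)
        (h0.applyMove hc _) (hG.mem_Phi _ _ _) ?_ ?_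
      · intro k _ hk l h
        have := hv.inj i hid.le k (by omega) (Prod.ext_iff.1 h).1
        omega
      · rwa [freeLeaves_applyMove_of_ne]
        intro l h
        have := hv.inj i hid.le 0 (by omega) (Prod.ext_iff.1 h).1
        omega
      · intro _
        have := hv.free i hi hid
        have := freeLeaves_le_applyMove c (v i) (v i, some j) a
        omega
    -- Bob forces the color of the first vertex
    have force : ∀ (v : ℕ → W) (c : W × Option (Fin 8) → Option α) (b b' : Bool), 0 < d →
        (Odd d ↔ b = b') → FreshPath G c v d → Sees G χ c (v 0) b → Sees G χ c (v d) b' →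
        3 ≤ freeLeaves c (v 0) → 4 ≤ freeLeaves c (v d) → BobWins G .bob c := by
      intro v c b b' hd hpar hv h0 h1 hf hf'
      obtain ⟨f, g, hfg⟩ := hχ (!b)
      obtain ⟨i, hi⟩ := exists_leaf_legalMove hG (hv.unc 0 (by omega)) (by omega)
      have hsee : ∀ x, x ≠ g → x ∈ Phi G (applyMove c (v 0, some i) f) (v 0, none) := by
        intro x hx
        by_cases hxb : χ x = b
        · exact h0.applyMove (hi f).1 f x hxb
        · rcases hfg x (by revert hxb; cases χ x <;> cases b <;> simp) with rfl | rfl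
          · exact hG.mem_Phi _ _ _
          · exact absurd rfl hx
      have hne : ∀ k, 0 < k → k ≤ d → v 0 ≠ v k := fun k hk hkd h => by
        have := hv.inj 0 (by omega) k hkd h
        omega
      have hv1 : FreshPath G (applyMove c (v 0, some i) f) v d := by
        refine hv.applyMove _ (by simp) fun k hk hkd l h => ?_
        exact hne k hk hkd.le (Prod.ext_iff.1 h).1
      have hf1 := freeLeaves_le_applyMove c (v 0) (v 0, some i) f
      have hf1' : freeLeaves (applyMove c (v 0, some i) f) (v d) = freeLeaves c (v d) :=
        freeLeaves_applyMove_of_ne _ fun l h => hne d hd le_rfl (Prod.ext_iff.1 h).1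
      refine .bobMove c _ f (hi f) (.of_alice ⟨_, hv1.unc 0 (by omega)⟩ fun w a hwa => ?_)
      by_cases hw : w = (v 0, none)
      · subst hw
        have hab : χ a ≠ b := fun h =>
          hwa.notMem_Phi (h0.applyMove (hi f).1 f a h)
        have := cut (fun k => v (d - k)) _ b' a d hd le_rfl ?_ hv1.reverse ?_ ?_
        · simpa using this
        · have : Odd (d - 1) ↔ ¬ Odd d := by
            obtain ⟨e, rfl⟩ : ∃ e, d = e + 1 := ⟨d - 1, by omega⟩
            simp [Nat.odd_add_one]
          rw [this, hpar]
          revert hab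
          cases χ a <;> cases b <;> cases b' <;> simp
        · simpa using h1.applyMove (hi f).1 f
        · simpa [hf1'] using hf'
      · refine .of_almost_dead hG (v := v 0) ?_ ?_ g fun x hx => ?_
        · rw [applyMove_of_ne _ _ (Ne.symm hw)]
          exact hv1.unc 0 (by omega)
        · have := freeLeaves_le_applyMove (applyMove c (v 0, some i) f) (v 0) w a
          omega
        · exact Phi_subset_applyMove hwa.1 _ _ (hsee x hx)
    intro v c b b' hpar hv h0 h1 hf hf'
    rcases Nat.eq_zero_or_pos d with rfl | hd
    · refine .of_dead _ (hv.unc 0 le_rfl) fun a => ?_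
      by_cases hab : χ a = b
      · exact h0 a hab
      · refine h1 a ?_
        simp only [Nat.not_odd_zero, false_iff] at hpar
        revert hab hpar
        cases χ a <;> cases b <;> cases b' <;> simp
    have hpar' : Odd d ↔ b' = b := hpar.trans eq_comm
    have hr0 : Sees G χ c (v (d - 0)) b' := h1
    have hr1 : Sees G χ c (v (d - d)) b := by simpa using h0
    have hrf : 4 ≤ freeLeaves c (v (d - 0)) := hf'
    have hrf' : 4 ≤ freeLeaves c (v (d - d)) := by simpa using hf
    refine .of_alice ⟨_, hv.unc 0 (by omega)⟩ fun w a hwa => ?_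
    by_cases hw : ∃ i ≤ d, w = (v i, none)
    · obtain ⟨i, hid, rfl⟩ := hw
      have h0a : i = 0 → χ a ≠ b := by
        rintro rfl h
        exact hwa.notMem_Phi (h0 a h)
      have hda : i = d → χ a ≠ b' := by
        rintro rfl h
        exact hwa.notMem_Phi (h1 a h)
      have key : (0 < i ∧ (Odd (i - 1) ↔ b = χ a)) ∨
          (0 < d - i ∧ (Odd (d - i - 1) ↔ b' = χ a)) := odd_split_of_ne hid hpar h0a hda
      rcases key with ⟨hi, hp⟩ | ⟨hi, hp⟩
      · exact cut v c b a i hi hid hp hv h0 hf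
      · have := cut (fun k => v (d - k)) c b' a (d - i) hi (by omega) hp hv.reverse hr0 hrf
        simpa [Nat.sub_sub_self hid] using this
    · push Not at hw
      by_cases hw' : ∃ i, 0 < i ∧ i < d ∧ ∃ j, w = (v i, some j)
      · obtain ⟨i, hi, hid, j, rfl⟩ := hw'
        have key : (Odd i ↔ b = χ a) ∨ (Odd (d - i) ↔ b' = χ a) :=
          odd_split hid.le hpar (χ a)
        rcases key with hp | hp
        · exact nip v c b a i j hi hid hp hv h0 hf hwa.1
        · have := nip (fun k => v (d - k)) c b' a (d - i) j (by omega) (by omega) hp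
            hv.reverse hr0 hrf (by simpa [Nat.sub_sub_self hid.le] using hwa.1)
          simpa [Nat.sub_sub_self hid.le] using this
      · push Not at hw'
        have hv1 := hv.applyMove a hw hw'
        have hl0 := freeLeaves_le_applyMove c (v 0) w a
        have hld := freeLeaves_le_applyMove c (v d) w a
        by_cases hwd : ∃ j, w = (v d, some j)
        · obtain ⟨j, rfl⟩ := hwd
          have : freeLeaves (applyMove c (v d, some j) a) (v 0) = freeLeaves c (v 0) := by
            refine freeLeaves_applyMove_of_ne _ fun l h => ?_
            have := hv.inj d le_rfl 0 (by omega) (Prod.ext_iff.1 h).1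
            omega
          refine force (fun k => v (d - k)) _ b' b hd hpar' hv1.reverse
            (hr0.applyMove hwa.1 a) (hr1.applyMove hwa.1 a) (by simp; omega) (by simp; omega)
        · push Not at hwd
          exact force v _ b b' hd hpar hv1 (h0.applyMove hwa.1 a) (h1.applyMove hwa.1 a)
            (by omega) (by rw [freeLeaves_applyMove_of_ne _ hwd]; exact hf')

end Pendant

section Tadpole

variable {W α : Type} {G : SimpleGraph (W × Option (Fin 8))}
  {c : W × Option (Fin 8) → Option α} {t : ℕ → W} {p N : ℕ}

/-- Core vertices `t 0, …, t N` forming a path, with `t p, …, t N` closing up to an odd cycle. -/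
structure Tadpole (G : SimpleGraph (W × Option (Fin 8))) (t : ℕ → W) (p N : ℕ) : Prop where
  adj : ∀ i < N, G.Adj (t i, none) (t (i + 1), none)
  inj : ∀ i ≤ N, ∀ j ≤ N, t i = t j → i = j
  closing : G.Adj (t p, none) (t N, none)
  two_le : p + 2 ≤ N
  even : Even (N - p)

/-- The tadpole is uncolored, and each of its vertices other than `t 0` has `k` free leaves. -/
structure Unused (c : W × Option (Fin 8) → Option α) (t : ℕ → W) (N k : ℕ) : Prop where
  unc : ∀ i ≤ N, c (t i, none) = none
  free : ∀ i, 0 < i → i ≤ N → k ≤ freeLeaves c (t i)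

theorem Tadpole.drop (h : Tadpole G t p N) {i : ℕ} (hi : i ≤ p) :
    Tadpole G (fun j => t (i + j)) (p - i) (N - i) where
  adj j hj := h.adj (i + j) (by omega)
  inj j hj k hk hjk := by
    have := h.two_le
    have := h.inj _ (by omega) _ (by omega) hjk
    omega
  closing := by
    have := h.two_le
    simpa [show i + (p - i) = p by omega, show i + (N - i) = N by omega] using h.closing
  two_le := by
    have := h.two_le
    omega
  even := by
    have := h.even
    rwa [show N - i - (p - i) = N - p by omega]

theorem Tadpole.freshPath (h : Tadpole G t p N) {k : ℕ} (hu : Unused c t N k) (hk : 6 ≤ k) :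
    FreshPath G c t N where
  adj := h.adj
  inj := h.inj
  unc := hu.unc
  free i h0 hi := hk.trans (hu.free i h0 hi.le)

/-- The path that goes around the cycle in the other direction. -/
theorem Tadpole.freshPath_around (h : Tadpole G t p N) {k : ℕ} (hu : Unused c t N k)
    (hk : 6 ≤ k) :
    FreshPath G c (fun i => if i ≤ p then t i else t (N + p + 1 - i)) (N - 1) where
  adj i hi := by
    have := h.two_le
    rcases lt_trichotomy i p with hip | rfl | hip
    · simpa [hip.le, show i + 1 ≤ p from hip] using h.adj i (by omega)
    · simpa [show N + i + 1 - (i + 1) = N by omega] using h.closing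
    · have := h.adj (N + p + 1 - (i + 1)) (by omega)
      rw [show N + p + 1 - (i + 1) + 1 = N + p + 1 - i by omega] at this
      simpa [show ¬ i ≤ p by omega, show ¬ i + 1 ≤ p by omega] using this.symm
  inj i hi j hj hij := by
    have := h.two_le
    split_ifs at hij <;> have := h.inj _ (by omega) _ (by omega) hij <;> omega
  unc i hi := by
    have := h.two_le
    split_ifs <;> exact hu.unc _ (by omega)
  free i h0 hi := by
    have := h.two_le
    split_ifs <;> exact hk.trans (hu.free _ (by omega) (by omega))

theorem not_colorable_of_tadpole (h : Tadpole G t p N) {k : ℕ} (hk : k ≤ 2) :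
    IsEmpty (G.Coloring (Fin k)) := by
  constructor
  intro f
  have htwo : ∀ x y z : Fin k, x ≠ y → y ≠ z → x = z := by omega
  have key : ∀ j, p + 2 * j ≤ N → f (t (p + 2 * j), none) = f (t p, none) := by
    intro j
    induction j with
    | zero => intro; rfl
    | succ j ih =>
      intro hj
      rw [← ih (by omega)]
      exact htwo _ _ _ (f.valid (h.adj (p + 2 * j + 1) (by omega)).symm)
        (f.valid (h.adj (p + 2 * j) (by omega)).symm)
  obtain ⟨j, hj⟩ := h.even
  have := h.two_le
  have := key j (by omega)
  rw [show p + 2 * j = N by omega] at this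
  exact f.valid h.closing this.symm

theorem Unused.applyMove [DecidableEq (W × Option (Fin 8))] {k : ℕ} (h : Unused c t N k)
    {w : W × Option (Fin 8)} (a : α) (hw : ∀ i ≤ N, w ≠ (t i, none))
    (hw' : ∀ i, 0 < i → i ≤ N → ∀ j, w ≠ (t i, some j)) : Unused (applyMove c w a) t N k where
  unc i hi := by
    rw [applyMove_of_ne _ _ (hw i hi).symm]
    exact h.unc i hi
  free i h0 hi := by
    rw [freeLeaves_applyMove_of_ne _ (hw' i h0 hi)]
    exact h.free i h0 hi

variable [DecidableEq α]

/-- The two-class partition of the colors given by a pair and its complement. -/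
def pairClass (s₁ s₂ : α) (a : α) : Bool := decide (a = s₁ ∨ a = s₂)

theorem smallClasses_pairClass [Fintype α] (hα : Fintype.card α ≤ 4) {s₁ s₂ : α} (hs : s₁ ≠ s₂) :
    SmallClasses (pairClass s₁ s₂) := by
  intro b
  cases b with
  | true => exact ⟨s₁, s₂, fun a ha => by simpa [pairClass] using ha⟩
  | false =>
    have hcard : (({s₁, s₂} : Finset α)ᶜ).card ≤ 2 := by
      rw [Finset.card_compl, Finset.card_pair hs]
      omega
    obtain ⟨f, g, h⟩ : ∃ f g, ∀ a ∈ ({s₁, s₂} : Finset α)ᶜ, a = f ∨ a = g := by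
      interval_cases hn : (({s₁, s₂} : Finset α)ᶜ).card
      · rw [Finset.card_eq_zero] at hn
        exact ⟨s₁, s₁, by simp [hn]⟩
      · obtain ⟨f, hf⟩ := Finset.card_eq_one.1 hn
        exact ⟨f, f, by simp [hf]⟩
      · obtain ⟨f, g, -, hf⟩ := Finset.card_eq_two.1 hn
        exact ⟨f, g, by simp [hf]⟩
    refine ⟨f, g, fun a ha => h a ?_⟩
    simpa [pairClass] using ha

theorem exists_ne_ne [Fintype α] (hα : 3 ≤ Fintype.card α) (x y : α) : ∃ z, z ≠ x ∧ z ≠ y := by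
  by_contra! h
  have : (Finset.univ : Finset α) ⊆ {x, y} := fun z _ => by
    by_cases hz : z = x
    · simp [hz]
    · simp [h z hz]
  have := Finset.card_le_card this
  have := Finset.card_le_two (a := x) (b := y)
  rw [Finset.card_univ] at *
  omega

theorem sees_pairClass {s₁ s₂ : α} {v : W} (h₁ : s₁ ∈ Phi G c (v, none))
    (h₂ : s₂ ∈ Phi G c (v, none)) : Sees G (pairClass s₁ s₂) c v true := by
  intro a ha
  rcases (by simpa [pairClass] using ha : a = s₁ ∨ a = s₂) with rfl | rfl
  · exact h₁
  · exact h₂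

variable [DecidableEq (W × Option (Fin 8))]

set_option maxHeartbeats 1000000 in
/-- Bob wins, with Alice to move, if the tip of the tadpole sees two colors and a neighbor of the
attaching vertex on the cycle sees a color of the appropriate kind. -/
theorem Tadpole.bobWins_alice [Finite W] [Fintype α] (hG : HasPendantLeaves G)
    (hα : 3 ≤ Fintype.card α) (hα' : Fintype.card α ≤ 4) {s₁ s₂ x : α} (hs : s₁ ≠ s₂)
    (h : Tadpole G t p N) (hu : Unused c t N 7) (hf : 5 ≤ freeLeaves c (t 0))
    (h₁ : s₁ ∈ Phi G c (t 0, none)) (h₂ : s₂ ∈ Phi G c (t 0, none))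
    (hx : x ∈ Phi G c (t (p + 1), none)) (hpar : Even p ↔ (x = s₁ ∨ x = s₂)) :
    BobWins G .alice c := by
  induction p using Nat.strong_induction_on generalizing t N c s₁ s₂ with
  | _ p ih =>
  have hN := h.two_le
  have hpath := h.freshPath hu (by omega)
  have hsmall := smallClasses_pairClass hα' hs
  have hsee := sees_pairClass h₁ h₂
  refine .of_alice ⟨_, hu.unc 0 (by omega)⟩ fun w a hwa => ?_
  by_cases hw : ∃ i ≤ p + 1, w = (t i, none)
  · obtain ⟨i, hi, rfl⟩ := hw
    have hsee' := hsee.applyMove hwa.1 a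
    have hfree : ∀ v, freeLeaves (applyMove c (t i, none) a) v = freeLeaves c v :=
      fun v => freeLeaves_applyMove_of_ne a (by simp)
    have hne : ∀ j ≤ N, j ≠ i → t j ≠ t i := fun j hj hji hE => hji (h.inj j hj i (by omega) hE)
    rcases hi.eq_or_lt with rfl | hi
    · by_cases hgood : Odd p ↔ true = pairClass s₁ s₂ a
      · refine (endsWin hG hsmall p).bobWins hG hsmall hgood
          ((hpath.take (by omega)).applyMove a ?_ (by simp)) hsee'
          (mem_Phi_applyMove (h.adj p (by omega)) a) ?_ ?_ ?_
        · intro j hj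
          simpa using (hne j (by omega) (by omega)).symm
        · rw [hfree]; omega
        · rw [hfree]
          rcases Nat.eq_zero_or_pos p with rfl | hp
          · omega
          · have := hu.free p hp (by omega)
            omega
        · intro hp
          rw [hfree]
          have := hu.free p hp (by omega)
          omega
      · have hlast : (if N - 1 ≤ p then t (N - 1) else t (N + p + 1 - (N - 1))) = t (p + 2) := by
          rw [if_neg (by omega)]
          congr 1
          omega
        refine (endsWin hG hsmall (N - 1)).bobWins hG hsmall (b := true) (a := a) ?_
          ((h.freshPath_around hu (by omega)).applyMove a ?_ (by simp)) (by simpa using hsee') ?_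
          ?_ ?_ ?_
        · have h1 : Odd (N - 1) ↔ ¬ Odd p := by
            have := h.even
            rw [Nat.even_iff] at this
            rw [Nat.odd_iff, Nat.odd_iff]
            omega
          rw [h1]
          tauto
        · intro j hj
          split_ifs
          · simpa using (hne j (by omega) (by omega)).symm
          · simpa using (hne (N + p + 1 - j) (by omega) (by omega)).symm
        · simp only [hlast]
          exact mem_Phi_applyMove (h.adj (p + 1) (by omega)).symm a
        · intro _
          rw [hfree]
          simp; omega
        · simp only [hlast, hfree]
          have := hu.free (p + 2) (by omega) (by omega)
          omega
        · simp only [hlast, hfree]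
          have := hu.free (p + 2) (by omega) (by omega)
          omega
    replace hi : i ≤ p := by omega
    by_cases hgood : 0 < i ∧ (Odd (i - 1) ↔ true = pairClass s₁ s₂ a)
    · obtain ⟨hi0, hgood⟩ := hgood
      have hadj := h.adj (i - 1) (by omega)
      rw [Nat.sub_add_cancel hi0] at hadj
      refine (endsWin hG hsmall (i - 1)).bobWins hG hsmall hgood
        ((hpath.take (by omega)).applyMove a ?_ (by simp)) hsee'
        (mem_Phi_applyMove hadj a) ?_ ?_ ?_
      · intro j hj
        simpa using (hne j (by omega) (by omega)).symm
      · rw [hfree]; omega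
      · rw [hfree]
        rcases Nat.eq_zero_or_pos (i - 1) with h0 | h0
        · rw [h0]; omega
        · have := hu.free (i - 1) h0 (by omega)
          omega
      · intro h0
        rw [hfree]
        have := hu.free (i - 1) h0 (by omega)
        omega
    -- the color `a` has the wrong kind, so it can be used for a shorter tadpole
    have hbad : Even i ↔ ¬ (a = s₁ ∨ a = s₂) := by
      rcases Nat.eq_zero_or_pos i with rfl | hi0
      · simp only [Even.zero, true_iff]
        rintro (rfl | rfl)
        · exact hwa.notMem_Phi h₁
        · exact hwa.notMem_Phi h₂
      · have h1 : ¬ (Odd (i - 1) ↔ (a = s₁ ∨ a = s₂)) := by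
          intro h1
          exact hgood ⟨hi0, by simpa [pairClass] using h1⟩
        have h2 : Odd (i - 1) ↔ Even i := by
          rw [Nat.odd_iff, Nat.even_iff]
          omega
        rw [h2] at h1
        tauto
    have hxa : (Even p ↔ Even i) → x ≠ a := by
      rintro hpi rfl
      tauto
    rcases hi.eq_or_lt with rfl | hip
    · have hxa := hxa Iff.rfl
      have hsmall' := smallClasses_pairClass hα' hxa
      have hend : i + 1 + (N - i - 1) = N := by omega
      have hadj : G.Adj (t (i + 1), none) (t i, none) := (h.adj i (by omega)).symm
      have hp' : FreshPath G (applyMove c (t i, none) a) (fun j => t (i + 1 + j)) (N - i - 1) := by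
        constructor
        · intro j hj
          exact h.adj (i + 1 + j) (by omega)
        · intro j hj k hk hjk
          have := h.inj _ (by omega) _ (by omega) hjk
          omega
        · intro j hj
          rw [applyMove_of_ne]
          · exact hu.unc _ (by omega)
          · simpa using hne (i + 1 + j) (by omega) (by omega)
        · intro j hj hj'
          rw [hfree]
          have := hu.free (i + 1 + j) (by omega) (by omega)
          omega
      refine (endsWin hG hsmall' (N - i - 1)).bobWins hG hsmall' (b := true) (a := a) ?_ hp'
        (sees_pairClass (Phi_subset_applyMove hwa.1 a _ hx) (mem_Phi_applyMove hadj a)) ?_ ?_ ?_ ?_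
      · have := h.even
        rw [Nat.even_iff] at this
        simp only [pairClass, or_true, decide_true, iff_true, Nat.odd_iff]
        omega
      · simp only [hend]
        exact mem_Phi_applyMove h.closing.symm a
      all_goals
        simp only [hend, hfree]
        have := hu.free N (by omega) le_rfl
        have := hu.free (i + 1 + 0) (by omega) (by omega)
        omega
    · obtain ⟨y, hya, hy⟩ : ∃ y, a ≠ y ∧ (Even (p - (i + 1)) ↔ (x = a ∨ x = y)) := by
        have h1 : Even (p - (i + 1)) ↔ ¬ (Even p ↔ Even i) := by
          simp only [Nat.even_iff]
          omega
        obtain ⟨z, hza, hzx⟩ := exists_ne_ne hα a x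
        by_cases hpi : Even p ↔ Even i
        · refine ⟨z, hza.symm, ?_⟩
          have := hxa hpi
          have := hzx.symm
          tauto
        · by_cases hxa : x = a
          · exact ⟨z, hza.symm, by tauto⟩
          · exact ⟨x, Ne.symm hxa, by tauto⟩
      have hu' : ∀ j, i < j → j ≤ N → applyMove c (t i, none) a (t j, none) = none := by
        intro j hj hjN
        rw [applyMove_of_ne _ _ (by simpa using hne j hjN (by omega))]
        exact hu.unc j hjN
      have h7 := hu.free (i + 1) (by omega) (by omega)
      obtain ⟨l, hl⟩ := exists_leaf_legalMove hG (hu' (i + 1) (by omega) (by omega))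
        (by rw [hfree]; omega)
      have hle := freeLeaves_le_applyMove (applyMove c (t i, none) a) (t (i + 1))
        (t (i + 1), some l) y
      rw [hfree] at hle
      refine .bobMove _ _ y (hl y) (ih (p - (i + 1)) (by omega) hya (h.drop hip) ?_ ?_ ?_ ?_ ?_ hy)
      · constructor
        · intro j hj
          rw [applyMove_of_ne _ _ (by simp)]
          exact hu' _ (by omega) (by omega)
        · intro j hj hjN
          rw [freeLeaves_applyMove_of_ne, hfree]
          · exact hu.free _ (by omega) (by omega)
          · intro k hk
            have := h.inj _ (by omega) _ (by omega) (Prod.ext_iff.1 hk).1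
            omega
      · simp only [add_zero]
        omega
      · exact Phi_subset_applyMove (hl y).1 _ _ (mem_Phi_applyMove (h.adj i (by omega)).symm a)
      · exact hG.mem_Phi _ _ _
      · rw [show i + 1 + (p - (i + 1) + 1) = p + 1 by omega]
        exact Phi_subset_applyMove (hl y).1 _ _ (Phi_subset_applyMove hwa.1 _ _ hx)
  · push Not at hw
    have hfree := fun v => freeLeaves_le_applyMove c v w a
    refine (endsWin hG hsmall (p + 1)).bobWins hG hsmall (b := true) (a := x) ?_ ?_
      (hsee.applyMove hwa.1 a) (Phi_subset_applyMove hwa.1 a _ hx) ?_ ?_ ?_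
    · have : Odd (p + 1) ↔ Even p := by
        rw [Nat.odd_iff, Nat.even_iff]
        omega
      rw [this, hpar]
      simp [pairClass]
    · constructor
      · exact fun j hj => h.adj j (by omega)
      · exact fun j hj k hk => h.inj j (by omega) k (by omega)
      · intro j hj
        rw [applyMove_of_ne _ _ (hw j hj).symm]
        exact hu.unc j (by omega)
      · intro j hj hjp
        have := hu.free j hj (by omega)
        have := hfree (t j)
        omega
    · have := hfree (t 0)
      omega
    all_goals
      have := hu.free (p + 1) (by omega) (by omega)
      have := hfree (t (p + 1))
      omega

/-- Bob wins, with Bob to move, if the tip of an unused tadpole sees two colors. -/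
theorem Tadpole.bobWins [Finite W] [Fintype α] (hG : HasPendantLeaves G)
    (hα : 3 ≤ Fintype.card α) (hα' : Fintype.card α ≤ 4) {s₁ s₂ : α} (hs : s₁ ≠ s₂)
    (h : Tadpole G t p N) (hu : Unused c t N 8) (hf : 5 ≤ freeLeaves c (t 0))
    (h₁ : s₁ ∈ Phi G c (t 0, none)) (h₂ : s₂ ∈ Phi G c (t 0, none)) :
    BobWins G .bob c := by
  have hN := h.two_le
  obtain ⟨x, hx⟩ : ∃ x, Even p ↔ (x = s₁ ∨ x = s₂) := by
    by_cases hp : Even p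
    · exact ⟨s₁, by simp [hp]⟩
    · obtain ⟨x, hx, hx'⟩ := exists_ne_ne hα s₁ s₂
      exact ⟨x, by simp [hp, hx, hx']⟩
  have h8 := hu.free (p + 1) (by omega) (by omega)
  obtain ⟨l, hl⟩ := exists_leaf_legalMove hG (hu.unc (p + 1) (by omega)) (by omega)
  have hfree := fun v => freeLeaves_le_applyMove c v (t (p + 1), some l) x
  refine .bobMove _ _ x (hl x) (h.bobWins_alice hG hα hα' hs ⟨?_, ?_⟩ ?_
    (Phi_subset_applyMove (hl x).1 _ _ h₁) (Phi_subset_applyMove (hl x).1 _ _ h₂)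
    (hG.mem_Phi _ _ _) hx)
  · intro i hi
    rw [applyMove_of_ne _ _ (by simp)]
    exact hu.unc i hi
  · intro i h0 hi
    have := hu.free i h0 hi
    have := hfree (t i)
    omega
  · rw [freeLeaves_applyMove_of_ne]
    · exact hf
    · intro k hk
      have := h.inj _ (by omega) _ (by omega) (Prod.ext_iff.1 hk).1
      omega

end Tadpole

section Hub

variable {W α : Type} {G : SimpleGraph (W × Option (Fin 8))}
  {c : W × Option (Fin 8) → Option α} {x y : W} {T T' : Fin 2 → ℕ → W} {p N : ℕ}

/-- Two tadpoles attached to `x`, disjoint apart from `x` and avoiding `y`. -/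
structure Hub (G : SimpleGraph (W × Option (Fin 8))) (x y : W) (T : Fin 2 → ℕ → W) (p N : ℕ) :
    Prop where
  tadpole : ∀ j, Tadpole G (T j) p N
  base : ∀ j, T j 0 = x
  disj : ∀ i i', 0 < i → 0 < i' → T 0 i ≠ T 1 i'
  avoid : ∀ j i, T j i ≠ y

theorem Hub.exists_untouched (h : Hub G x y T p N) (v : W) : ∃ j, ∀ i, 0 < i → v ≠ T j i := by
  by_contra! H
  obtain ⟨i, hi, h0⟩ := H 0
  obtain ⟨i', hi', h1⟩ := H 1
  exact h.disj i i' hi hi' (h0.symm.trans h1)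

theorem Hub.ne (h : Hub G x y T p N) {j : Fin 2} (i : ℕ) (hi : 0 < i) (hN : i ≤ N) :
    x ≠ T j i := by
  intro hE
  have := (h.tadpole j).inj 0 (by omega) i hN ((h.base j).trans hE)
  omega

variable [DecidableEq (W × Option (Fin 8))]

theorem Hub.unused_applyMove (h : Hub G x y T p N) {j : Fin 2} {k : ℕ} (hu : Unused c (T j) N k)
    {w : W × Option (Fin 8)} (a : α) (hw : w ≠ (x, none)) (hw' : ∀ i, 0 < i → i ≤ N → w.1 ≠ T j i) :
    Unused (applyMove c w a) (T j) N k := by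
  refine hu.applyMove a ?_ ?_
  · rintro i hN rfl
    rcases Nat.eq_zero_or_pos i with rfl | hi
    · exact hw (by rw [h.base])
    · exact hw' i hi hN rfl
  · rintro i hi hN l rfl
    exact hw' i hi hN rfl

variable [DecidableEq α] [Fintype α] [Finite W]

/-- Bob wins when Alice has just colored the neighbor `y` of a hub `x`. -/
theorem Hub.bobWins_of_color (hG : HasPendantLeaves G)
    (hα : 3 ≤ Fintype.card α) (hα' : Fintype.card α ≤ 4) (h : Hub G x y T p N) {j : Fin 2}
    (hu : Unused c (T j) N 8) (hf : 5 ≤ freeLeaves c x) (hxy : G.Adj (x, none) (y, none))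
    {a₀ a : α} (hx : a₀ ∈ Phi G c (x, none)) (hy : a₀ ∈ Phi G c (y, none))
    (ha : legalMove G c (y, none) a) : BobWins G .bob (applyMove c (y, none) a) := by
  have hne : a₀ ≠ a := by
    rintro rfl
    exact ha.notMem_Phi hy
  refine (h.tadpole j).bobWins hG hα hα' hne (h.unused_applyMove hu a ?_ ?_) ?_ ?_ ?_
  · exact hxy.ne'
  · exact fun i _ _ hE => h.avoid j i hE.symm
  · rw [freeLeaves_applyMove_of_ne _ (by simp), h.base]
    exact hf
  · rw [h.base]
    exact Phi_subset_applyMove ha.1 a _ hx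
  · rw [h.base]
    exact mem_Phi_applyMove hxy a

/-- With Alice to move at two adjacent hubs seeing a common color, Bob only has to worry about
moves coloring neither of the hubs. -/
theorem Hub.bobWins_alice (hG : HasPendantLeaves G)
    (hα : 3 ≤ Fintype.card α) (hα' : Fintype.card α ≤ 4) (h : Hub G x y T p N)
    (h' : Hub G y x T' p N) {j j' : Fin 2} (hu : Unused c (T j) N 8) (hu' : Unused c (T' j') N 8)
    (hx : 5 ≤ freeLeaves c x) (hy : 5 ≤ freeLeaves c y) (hxy : G.Adj (x, none) (y, none))
    {a₀ : α} (hax : a₀ ∈ Phi G c (x, none)) (hay : a₀ ∈ Phi G c (y, none))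
    (H : ∀ w a, legalMove G c w a → w ≠ (x, none) → w ≠ (y, none) →
      BobWins G .bob (applyMove c w a)) : BobWins G .alice c := by
  refine .of_alice ⟨_, hu.unc 0 (Nat.zero_le _)⟩ fun w a hwa => ?_
  by_cases hwx : w = (x, none)
  · subst hwx
    exact h'.bobWins_of_color hG hα hα' hu' hy hxy.symm hay hax hwa
  by_cases hwy : w = (y, none)
  · subst hwy
    exact h.bobWins_of_color hG hα hα' hu hx hxy hax hay hwa
  exact H w a hwa hwx hwy

/-- Bob wins, with Bob to move, if there are two adjacent unused hubs one of which sees a color. -/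
theorem Hub.bobWins (hG : HasPendantLeaves G)
    (hα : 3 ≤ Fintype.card α) (hα' : Fintype.card α ≤ 4) (h : Hub G x y T p N)
    (h' : Hub G y x T' p N) (hu : ∀ j, Unused c (T j) N 8) (hu' : ∀ j, Unused c (T' j) N 8)
    (hx : 8 ≤ freeLeaves c x) (hy : 8 ≤ freeLeaves c y) (hxy : G.Adj (x, none) (y, none))
    {a₀ : α} (ha₀ : a₀ ∈ Phi G c (y, none)) : BobWins G .bob c := by
  have hne : x ≠ y := fun hE => hxy.ne (by rw [hE])
  have hcx : c (x, none) = none := by simpa [h.base] using (hu 0).unc 0 (Nat.zero_le _)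
  have hcy : c (y, none) = none := by simpa [h'.base] using (hu' 0).unc 0 (Nat.zero_le _)
  obtain ⟨l, hl⟩ := exists_leaf_legalMove hG hcx (by omega)
  replace hl := hl a₀
  refine .bobMove c _ a₀ hl ?_
  have hx₁ := freeLeaves_le_applyMove c x (x, some l) a₀
  have hy₁ := freeLeaves_le_applyMove c y (x, some l) a₀
  have hax₁ := hG.mem_Phi (c := c) x l a₀
  have hay₁ := Phi_subset_applyMove hl.1 a₀ _ ha₀
  have hcx₁ : applyMove c (x, some l) a₀ (x, none) = none := by
    rwa [applyMove_of_ne _ _ (by simp)]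
  have hcy₁ : applyMove c (x, some l) a₀ (y, none) = none := by
    rwa [applyMove_of_ne _ _ (by simp)]
  have hu₁ : ∀ j, Unused (applyMove c (x, some l) a₀) (T j) N 8 := fun j =>
    h.unused_applyMove (hu j) _ (by simp) h.ne
  have hu₁' : ∀ j, Unused (applyMove c (x, some l) a₀) (T' j) N 8 := fun j =>
    h'.unused_applyMove (hu' j) _ (by simp) fun i _ _ => (h'.avoid j i).symm
  generalize applyMove c (x, some l) a₀ = c₁ at *
  refine h.bobWins_alice hG hα hα' h' (hu₁ 0) (hu₁' 0) (by omega) (by omega) hxy hax₁ hay₁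
    fun w a hwa hwx hwy => ?_
  obtain ⟨j, hj⟩ := h.exists_untouched w.1
  obtain ⟨j', hj'⟩ := h'.exists_untouched w.1
  have hu₂ := h.unused_applyMove (hu₁ j) a hwx fun i hi _ => hj i hi
  have hu₂' := h'.unused_applyMove (hu₁' j') a hwy fun i hi _ => hj' i hi
  have hx₂ := freeLeaves_le_applyMove c₁ x w a
  have hy₂ := freeLeaves_le_applyMove c₁ y w a
  have hax₂ := Phi_subset_applyMove hwa.1 a _ hax₁
  have hay₂ := Phi_subset_applyMove hwa.1 a _ hay₁
  generalize applyMove c₁ w a = c₂ at *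
  obtain ⟨e, he, -⟩ := exists_ne_ne hα a₀ a₀
  have hcy₂ : c₂ (y, none) = none := by simpa [h'.base] using hu₂'.unc 0 (Nat.zero_le _)
  obtain ⟨l', hl'⟩ := exists_leaf_legalMove hG hcy₂ (by omega)
  replace hl' := hl' e
  refine .bobMove c₂ _ e hl' ?_
  have hx₃ : freeLeaves (applyMove c₂ (y, some l') e) x = freeLeaves c₂ x :=
    freeLeaves_applyMove_of_ne _ fun k hk => hne (Prod.ext_iff.1 hk).1.symm
  have hy₃ := freeLeaves_le_applyMove c₂ y (y, some l') e
  have hax₃ := Phi_subset_applyMove hl'.1 e _ hax₂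
  have hay₃ := Phi_subset_applyMove hl'.1 e _ hay₂
  have hey₃ := hG.mem_Phi (c := c₂) y l' e
  have hu₃ := h.unused_applyMove hu₂ (w := (y, some l')) e (by simp)
    fun i _ _ => (h.avoid j i).symm
  have hu₃' := h'.unused_applyMove hu₂' (w := (y, some l')) e (by simp) h'.ne
  generalize applyMove c₂ (y, some l') e = c₃ at *
  refine h.bobWins_alice hG hα hα' h' hu₃ hu₃' (by omega) (by omega) hxy hax₃ hay₃
    fun w' a' hwa' hwx' hwy' => ?_
  have hx₄ := freeLeaves_le_applyMove c₃ x w' a'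
  have hy₄ := freeLeaves_le_applyMove c₃ y w' a'
  have hcx₃ : c₃ (x, none) = none := by simpa [h.base] using hu₃.unc 0 (Nat.zero_le _)
  have hcy₃ : c₃ (y, none) = none := by simpa [h'.base] using hu₃'.unc 0 (Nat.zero_le _)
  have hsmall := smallClasses_pairClass hα' he.symm
  refine (endsWin hG hsmall 1).bobWins hG hsmall (v := fun i => if i = 0 then y else x) (b := true)
    (a := a₀) (by simp [pairClass]) ?_ ?_ ?_ ?_ ?_ ?_
  · constructor
    · intro i hi
      obtain rfl : i = 0 := by omega
      exact hxy.symm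
    · intro i hi i' hi' hii'
      interval_cases i <;> interval_cases i' <;> simp_all [hne.symm]
    · intro i hi
      interval_cases i
      · simpa [applyMove_of_ne c₃ a' hwy'.symm] using hcy₃
      · simpa [applyMove_of_ne c₃ a' hwx'.symm] using hcx₃
    · intro i hi hi'
      omega
  · exact (sees_pairClass hay₃ hey₃).applyMove hwa'.1 a'
  · exact Phi_subset_applyMove hwa'.1 a' _ hax₃
  · simp only [if_true]
    omega
  all_goals
    simp only [one_ne_zero, if_false]
    omega

end Hub

section GraphLP

variable {ℓ p : ℕ}

theorem hasPendantLeaves_graphLP (ℓ p : ℕ) : HasPendantLeaves (GraphLP ℓ p) := by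
  rintro v i ⟨u, _ | k⟩
  · simp [GraphLP, gAdj, eq_comm]
  · simp [GraphLP, gAdj]

theorem graphLP_adj_of_baseAdj {b : Bool} {x y : BaseV ℓ p} (hne : x ≠ y) (h : baseAdj ℓ p x y) :
    (GraphLP ℓ p).Adj ((b, x), none) ((b, y), none) := by
  simp [GraphLP, gAdj, hne, h]

theorem graphLP_adj_copy {u v : GV ℓ p} (h : (GraphLP ℓ p).Adj u v) : u.1.1 = v.1.1 := by
  obtain ⟨⟨b, x⟩, _ | i⟩ := u <;> obtain ⟨⟨b', y⟩, _ | k⟩ := v <;>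
    simp [GraphLP, gAdj] at h <;> grind

/-- The vertices of the `j`-th attachment of the spine vertex `s`, starting with `s`, then along
the attaching path and once around the cycle. -/
def attachment (hl : 0 < ℓ) (p : ℕ) (b : Bool) (s : Fin 5) (j : Fin 2) (i : ℕ) : CoreV ℓ p :=
  (b, if i = 0 then .inl s else
    .inr (s, j, if h : i - 1 < p - 1 then .inl ⟨i - 1, h⟩ else
      .inr ⟨(i - p) % ℓ, Nat.mod_lt _ hl⟩))

variable (hl : 0 < ℓ) (b : Bool) (s : Fin 5) (j : Fin 2)

theorem attachment_zero : attachment hl p b s j 0 = (b, .inl s) := rfl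

theorem attachment_of_pos {i : ℕ} (hi : 0 < i) :
    ∃ q, attachment hl p b s j i = (b, .inr (s, j, q)) := by
  simp [attachment, hi.ne']

theorem attachment_of_lt {i : ℕ} (hi : 0 < i) (hip : i < p) :
    attachment hl p b s j i = (b, .inr (s, j, .inl ⟨i - 1, by omega⟩)) := by
  simp [attachment, hi.ne', show i - 1 < p - 1 by omega]

theorem attachment_add (hp : 1 ≤ p) {i : ℕ} (hi : i < ℓ) :
    attachment hl p b s j (p + i) = (b, .inr (s, j, .inr ⟨i, hi⟩)) := by
  simp [attachment, show p ≠ 0 by omega, show ¬ p + i - 1 < p - 1 by omega, Nat.mod_eq_of_lt hi]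

theorem attachment_self (hp : 1 ≤ p) :
    attachment hl p b s j p = (b, .inr (s, j, .inr ⟨0, hl⟩)) := by
  simpa using attachment_add hl b s j hp hl

theorem attachment_injOn (hp : 1 ≤ p) {i k : ℕ} (hi : i ≤ p + (ℓ - 1)) (hk : k ≤ p + (ℓ - 1))
    (h : attachment hl p b s j i = attachment hl p b s j k) : i = k := by
  have hcases : ∀ m ≤ p + (ℓ - 1), m = 0 ∨ (0 < m ∧ m < p) ∨ ∃ d, d < ℓ ∧ m = p + d := by
    intro m hm
    rcases Nat.eq_zero_or_pos m with h0 | h0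
    · exact .inl h0
    · by_cases hmp : m < p
      · exact .inr (.inl ⟨h0, hmp⟩)
      · exact .inr (.inr ⟨m - p, by omega, by omega⟩)
  rcases hcases i hi with rfl | ⟨hi, hip⟩ | ⟨d, hd, rfl⟩ <;>
    rcases hcases k hk with rfl | ⟨hk, hkp⟩ | ⟨d', hd', rfl⟩ <;>
    simp [attachment_zero, attachment_of_lt, attachment_add, *] at h ⊢ <;> omega

theorem attachment_baseAdj (hp : 1 ≤ p) {i : ℕ} (hi : i < p + (ℓ - 1)) :
    baseAdj ℓ p (attachment hl p b s j i).2 (attachment hl p b s j (i + 1)).2 := by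
  rcases Nat.eq_zero_or_pos i with rfl | h0
  · rcases hp.eq_or_lt with rfl | hp
    · rw [attachment_zero, zero_add, attachment_self _ _ _ _ le_rfl]
      simp [baseAdj]
    · rw [attachment_zero, attachment_of_lt _ _ _ _ (by omega) (by omega)]
      simp [baseAdj]
  · rcases lt_trichotomy (i + 1) p with hip | hip | hip
    · rw [attachment_of_lt _ _ _ _ h0 (by omega), attachment_of_lt _ _ _ _ (by omega) hip]
      simp only [baseAdj, true_and]
      omega
    · rw [attachment_of_lt _ _ _ _ h0 (by omega), hip, attachment_self _ _ _ _ hp]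
      simp only [baseAdj, true_and, and_true]
      omega
    · obtain ⟨d, rfl⟩ := Nat.exists_eq_add_of_le (show p ≤ i by omega)
      rw [add_assoc, attachment_add _ _ _ _ hp (by omega), attachment_add _ _ _ _ hp (by omega)]
      simp [baseAdj, Nat.mod_eq_of_lt (show d + 1 < ℓ by omega)]

theorem tadpole_attachment (hodd : Odd ℓ) (hl3 : 3 ≤ ℓ) (hp : 1 ≤ p) :
    Tadpole (GraphLP ℓ p) (attachment hl p b s j) p (p + (ℓ - 1)) where
  adj i hi := by
    refine graphLP_adj_of_baseAdj ?_ (attachment_baseAdj hl b s j hp hi)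
    intro h
    have := attachment_injOn hl b s j hp hi.le hi (Prod.ext rfl h)
    omega
  inj i hi k hk h := attachment_injOn hl b s j hp hi hk h
  closing := by
    rw [attachment_add _ _ _ _ hp (by omega), attachment_self _ _ _ _ hp]
    refine graphLP_adj_of_baseAdj ?_ ?_
    · simp only [ne_eq, Sum.inr.injEq, Prod.mk.injEq, Fin.mk.injEq, true_and]
      omega
    · simp [baseAdj, Nat.sub_add_cancel hl]
  two_le := by omega
  even := by
    rw [Nat.add_sub_cancel_left]
    exact Nat.Odd.sub_odd hodd odd_one

theorem hub_attachment (hodd : Odd ℓ) (hl3 : 3 ≤ ℓ) (hp : 1 ≤ p) {s' : Fin 5} (hs : s ≠ s') :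
    Hub (GraphLP ℓ p) (b, .inl s) (b, .inl s') (attachment hl p b s) p (p + (ℓ - 1)) where
  tadpole j := tadpole_attachment hl b s j hodd hl3 hp
  base _ := rfl
  disj i i' hi hi' := by
    obtain ⟨q, hq⟩ := attachment_of_pos (p := p) hl b s 0 hi
    obtain ⟨q', hq'⟩ := attachment_of_pos (p := p) hl b s 1 hi'
    simp [hq, hq']
  avoid j i := by
    rcases Nat.eq_zero_or_pos i with rfl | hi
    · simpa [attachment_zero] using hs
    · obtain ⟨q, hq⟩ := attachment_of_pos (p := p) hl b s j hi
      simp [hq]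

/-- The spine vertex to which a core vertex is attached. -/
def spine (v : CoreV ℓ p) : Fin 5 := v.2.elim id Prod.fst

theorem spine_attachment (i : ℕ) : spine (attachment hl p b s j i) = s := by
  simp only [spine, attachment]
  split_ifs <;> rfl

variable {α : Type} {c : GV ℓ p → Option α}

theorem freeLeaves_eq_eight {v : CoreV ℓ p} (h : ∀ i, c (v, some i) = none) :
    freeLeaves c v = 8 := by
  simp [freeLeaves, h, Set.ncard_univ]

theorem unused_attachment (h : ∀ u : GV ℓ p, u.1.1 = b → spine u.1 = s → c u = none) (N : ℕ) :
    Unused c (attachment hl p b s j) N 8 where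
  unc i _ := h _ rfl (spine_attachment hl b s j i)
  free i _ _ :=
    (freeLeaves_eq_eight fun _ => h _ rfl (spine_attachment hl b s j i)).ge

variable [DecidableEq α] [Fintype α]

/-- Bob wins the coloring game on `G(ℓ, p)` with three or four colors. -/
theorem bobWins_graphLP (hodd : Odd ℓ) (hl3 : 3 ≤ ℓ) (hp : 1 ≤ p)
    (hα : 3 ≤ Fintype.card α) (hα' : Fintype.card α ≤ 4) :
    BobWins (α := α) (GraphLP ℓ p) .alice (fun _ => none) := by
  have hl : 0 < ℓ := by omega
  obtain ⟨a₀⟩ : Nonempty α := Fintype.card_pos_iff.1 (by omega)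
  refine .of_alice ⟨((true, .inl 0), none), rfl⟩ fun w a _ => ?_
  obtain ⟨b, hb⟩ : ∃ b, b ≠ w.1.1 := ⟨!w.1.1, by simp⟩
  have h₁ : ∀ u : GV ℓ p, u.1.1 = b → applyMove (fun _ => none) w a u = none := by
    rintro u rfl
    exact applyMove_of_ne _ _ fun h => hb (by rw [h])
  generalize applyMove (fun _ => none) w a = c₁ at *
  set z : GV ℓ p := ((b, .inl 2), none) with hz
  have hlegal : legalMove (GraphLP ℓ p) c₁ z a₀ := by
    refine ⟨h₁ z rfl, fun u hu => ?_⟩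
    rw [h₁ u (graphLP_adj_copy hu).symm]
    simp
  refine .bobMove c₁ z a₀ hlegal (.of_alice ⟨((b, .inl 0), none), ?_⟩ fun w' a' hw' => ?_)
  · rw [applyMove_of_ne _ _ (by simp [hz])]
    exact h₁ _ rfl
  have h₃ : ∀ u : GV ℓ p, u.1.1 = b → spine u.1 ≠ 2 → spine u.1 ≠ spine w'.1 →
      applyMove (applyMove c₁ z a₀) w' a' u = none := by
    intro u hu hu' hu''
    rw [applyMove_of_ne, applyMove_of_ne]
    · exact h₁ u hu
    · rintro rfl
      exact hu' rfl
    · rintro rfl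
      exact hu'' rfl
  have hpair : ∀ s s' : Fin 5, s ≠ 2 → s' ≠ 2 → s ≠ spine w'.1 → s' ≠ spine w'.1 →
      (s.val + 1 = s'.val ∨ s'.val + 1 = s.val) → (s'.val + 1 = 2 ∨ 3 = s'.val) →
      BobWins (GraphLP ℓ p) .bob (applyMove (applyMove c₁ z a₀) w' a') := by
    intro s s' hs2 hs2' hsw hsw' hadj hadj'
    have hne : s ≠ s' := by omega
    have hs : ∀ u : GV ℓ p, u.1.1 = b → spine u.1 = s →
        applyMove (applyMove c₁ z a₀) w' a' u = none := by
      rintro u hu rfl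
      exact h₃ u hu hs2 hsw
    have hs' : ∀ u : GV ℓ p, u.1.1 = b → spine u.1 = s' →
        applyMove (applyMove c₁ z a₀) w' a' u = none := by
      rintro u hu rfl
      exact h₃ u hu hs2' hsw'
    refine (hub_attachment hl b s hodd hl3 hp hne).bobWins (hasPendantLeaves_graphLP ℓ p) hα hα'
      (hub_attachment hl b s' hodd hl3 hp hne.symm) (fun j => unused_attachment hl b s j hs _)
      (fun j => unused_attachment hl b s' j hs' _)
      (freeLeaves_eq_eight fun _ => hs _ rfl rfl).ge (freeLeaves_eq_eight fun _ => hs' _ rfl rfl).ge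
      (graphLP_adj_of_baseAdj (by simpa using hne) hadj)
      (Phi_subset_applyMove hw'.1 a' _ (mem_Phi_applyMove (graphLP_adj_of_baseAdj ?_ ?_) a₀))
    · simpa using hs2'
    · simp only [baseAdj, Fin.val_two]
      omega
  by_cases hside : spine w'.1 = 0 ∨ spine w'.1 = 1
  · refine hpair 4 3 (by decide) (by decide) ?_ ?_ (by decide) (by decide) <;>
      rcases hside with h | h <;> rw [h] <;> decide
  · push Not at hside
    exact hpair 0 1 (by decide) (by decide) hside.1.symm hside.2.symm (by decide) (by decide)

theorem five_le_of_aliceWins (hodd : Odd ℓ) (hl3 : 3 ≤ ℓ) (hp : 1 ≤ p) {k : ℕ}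
    (h : AliceWins (α := Fin k) (GraphLP ℓ p) .alice (fun _ => none)) : 5 ≤ k := by
  by_contra! hk
  by_cases hk3 : 3 ≤ k
  · exact h.not_bobWins (bobWins_graphLP hodd hl3 hp (by simpa using hk3) (by simp; omega))
  · obtain ⟨f⟩ := h.exists_coloring (by simp [ProperPartial])
    exact (not_colorable_of_tadpole
      (tadpole_attachment (by omega) true 0 0 hodd hl3 hp) (by omega)).false f

end GraphLP

end GCN

open GCN in
/-- For every odd `ℓ ≥ 3` and every `p ≥ 1`, Bob has a winning strategy in the coloring game
with 4 colors on the graph `G(ℓ, p)` (Alice moving first from the all-uncolored position);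
equivalently, `χ_g(G(ℓ, p)) ≥ 5`. -/
theorem statement10 (ℓ p : ℕ) (hodd : Odd ℓ) (hl : 3 ≤ ℓ) (hp : 1 ≤ p) :
    BobWins (α := Fin 4) (GraphLP ℓ p) .alice (fun _ => none) ∧
    5 ≤ gameChromaticNumber (GraphLP ℓ p) := by
  refine ⟨bobWins_graphLP hodd hl hp (by simp) (by simp), ?_⟩
  refine le_csInf ⟨Fintype.card (GV ℓ p) + 1, aliceWins_of_card_lt (by simp) _ _⟩ fun k hk => ?_
  exact five_le_of_aliceWins hodd hl hp hk
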